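/- Let A be a subspace arrangement embedded in a finite hyperplane arrangement H in V = k^n. Then the union of the subspaces of the double blocker A** equals the intersection over all X in the blocker A* of the sets V_{H/X}; that is, ⋃_{Y ∈ A**} Y = ⋂_{X ∈ A*} V_{H/X}. -/

import Mathlib

variable {k : Type*} [Field k] {n : ℕ}

/-- The intersection lattice of a hyperplane arrangement `H` in `k^n`: all
linear subspaces that are intersections of subsets of `H` (the empty
intersection being the whole space). -/
def intersectionLattice (H : Finset (Submodule k (Fin n → k))) :
    Set (Submodule k (Fin n → k)) :=
  {X | ∃ T ⊆ (H : Set (Submodule k (Fin n → k))), X = sInf T}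

/-- `A` is a subspace arrangement embedded in the hyperplane arrangement `H`:
a finite nonempty set of elements of the intersection lattice of `H`, none
equal to the whole space, pairwise incomparable under inclusion. -/
def IsEmbeddedArrangement (H : Finset (Submodule k (Fin n → k)))
    (A : Set (Submodule k (Fin n → k))) : Prop :=
  A.Finite ∧ A.Nonempty ∧ A ⊆ intersectionLattice H ∧ (∀ a ∈ A, a ≠ ⊤) ∧
    IsAntichain (· ≤ ·) A

/-- The blocker of `A` with respect to `H`: the maximal elements under
inclusion of the set of `X` in the intersection lattice such that for every
`a ∈ A` there is a hyperplane of `H` containing both `a` and `X`. -/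
def arrBlocker (H : Finset (Submodule k (Fin n → k)))
    (A : Set (Submodule k (Fin n → k))) : Set (Submodule k (Fin n → k)) :=
  {X | Maximal (fun Y => Y ∈ intersectionLattice H ∧
         ∀ a ∈ A, ∃ h ∈ H, a ≤ h ∧ Y ≤ h) X}

/-- `V_{H/X}`: the union, as a set of vectors, of the hyperplanes of `H`
containing `X`. -/
def VHX (H : Finset (Submodule k (Fin n → k))) (X : Submodule k (Fin n → k)) :
    Set (Fin n → k) :=
  ⋃ h ∈ {h ∈ (H : Set (Submodule k (Fin n → k))) | X ≤ h}, (h : Set (Fin n → k))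

theorem intersectionLattice_finite (H : Finset (Submodule k (Fin n → k))) :
    (intersectionLattice H).Finite := by
  refine (H.finite_toSet.finite_subsets.image sInf).subset ?_
  rintro X ⟨T, hT, rfl⟩
  exact ⟨T, hT, rfl⟩

/-- Every element of the intersection lattice satisfying the blocking condition lies below an
element of the blocker. -/
theorem exists_le_mem_arrBlocker {H : Finset (Submodule k (Fin n → k))}
    {A : Set (Submodule k (Fin n → k))} {Y : Submodule k (Fin n → k)}
    (hY : Y ∈ intersectionLattice H) (hYA : ∀ a ∈ A, ∃ h ∈ H, a ≤ h ∧ Y ≤ h) :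
    ∃ Z ∈ arrBlocker H A, Y ≤ Z := by
  have hfin : {Z | Z ∈ intersectionLattice H ∧ ∀ a ∈ A, ∃ h ∈ H, a ≤ h ∧ Z ≤ h}.Finite :=
    (intersectionLattice_finite H).subset fun _ hZ => hZ.1
  obtain ⟨Z, hYZ, hZ⟩ := hfin.exists_le_maximal (a := Y) ⟨hY, hYA⟩
  exact ⟨Z, hZ, hYZ⟩

theorem mem_VHX {H : Finset (Submodule k (Fin n → k))} {X : Submodule k (Fin n → k)}
    {v : Fin n → k} : v ∈ VHX H X ↔ ∃ h ∈ H, X ≤ h ∧ v ∈ h := by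
  simp [VHX, and_assoc]

/-- Part (3) of Proposition 3.9: `V_{A**} = ⋂_{X ∈ A*} V_{H/X}`. -/
theorem union_double_blocker_eq (H : Finset (Submodule k (Fin n → k)))
    (hH : ∀ h ∈ H, Module.finrank k h = n - 1)
    (A : Set (Submodule k (Fin n → k))) (hA : IsEmbeddedArrangement H A) :
    (⋃ Y ∈ arrBlocker H (arrBlocker H A), (Y : Set (Fin n → k)))
      = ⋂ X ∈ arrBlocker H A, VHX H X := by
  ext v
  simp only [Set.mem_iUnion, Set.mem_iInter, mem_VHX, SetLike.mem_coe, exists_prop]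
  constructor
  · rintro ⟨Y, hY, hv⟩ X hX
    obtain ⟨h, hh, hXh, hYh⟩ := hY.1.2 X hX
    exact ⟨h, hh, hXh, hYh hv⟩
  · intro hv
    obtain ⟨Z, hZ, hle⟩ := exists_le_mem_arrBlocker (H := H) (A := arrBlocker H A)
      (Y := sInf {h | h ∈ H ∧ v ∈ h}) ⟨_, fun h hh => hh.1, rfl⟩ fun X hX => by
        obtain ⟨h, hh, hXh, hvh⟩ := hv X hX
        exact ⟨h, hh, hXh, sInf_le ⟨hh, hvh⟩⟩
    exact ⟨Z, hZ, hle (Submodule.mem_sInf.2 fun h hh => hh.2)⟩
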